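/- arXiv:1910.08190 — 5 statements merged into one kernel-verified Lean document; each statement's English description precedes it below -/
import Mathlib

section
/- Let a : Fin n → ℝ, let v : Fin n → ℝ, let g ∈ ℝ, and let A := diag(a) + g · v vᵀ. Then a real number λ with λ ≠ a_i for all i is an eigenvalue of A (i.e. det(A − λI) = 0) if and only if g Σ_{i} v_i² / (λ − a_i) = 1. -/
open Matrix

theorem eigenvalue_secular_equation
    {n : ℕ} (a v : Fin n → ℝ) (g : ℝ)
    (A : Matrix (Fin n) (Fin n) ℝ)
    (hA : A = Matrix.diagonal a + g • vecMulVec v v)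
    (lam : ℝ) (hlam : ∀ i, lam ≠ a i) :
    (A - lam • 1).det = 0 ↔ g * ∑ i, v i ^ 2 / (lam - a i) = 1 := by
  have hne : ∀ i, a i - lam ≠ 0 := fun i => sub_ne_zero.mpr (hlam i).symm
  have hfac : A - lam • 1 = Matrix.diagonal (fun i => a i - lam) *
      (1 + replicateCol Unit (fun i => g * v i / (a i - lam)) * replicateRow Unit v) := by
    subst hA
    ext i j
    have h := hne i
    rw [Matrix.diagonal_mul]
    by_cases hij : i = j
    · subst hij
      simp [vecMulVec_apply, Matrix.mul_apply]
      field_simp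
      ring
    · simp [vecMulVec_apply, Matrix.mul_apply, hij]
      field_simp
  have hprod : (∏ i, (a i - lam)) ≠ 0 := Finset.prod_ne_zero_iff.mpr fun i _ => hne i
  have hsum : v ⬝ᵥ (fun i => g * v i / (a i - lam)) = -(g * ∑ i, v i ^ 2 / (lam - a i)) := by
    rw [dotProduct, Finset.mul_sum, ← Finset.sum_neg_distrib]
    refine Finset.sum_congr rfl fun i _ => ?_
    rw [← neg_sub (a i) lam, div_neg]
    ring
  rw [hfac, det_mul, det_diagonal, det_one_add_replicateCol_mul_replicateRow, hsum,
    mul_eq_zero, or_iff_right hprod]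
  constructor <;> intro h <;> linarith
end

section
/- Interlacing for a positive rank-one perturbation: let a_1 < a_2 < … < a_n be real numbers, let g > 0, and let v : Fin n → ℝ with v_i ≠ 0 for all i. Then the real symmetric matrix A := diag(a) + g · v vᵀ has n simple eigenvalues μ_1 < μ_2 < … < μ_n which strictly interlace the diagonal values: a_i < μ_i < a_{i+1} for 1 ≤ i ≤ n − 1, and μ_n > a_n. -/
open Matrix Polynomial

theorem r1_eval_generic {n : ℕ} (a v : Fin n → ℝ) (g t : ℝ) (ht : ∀ i, t ≠ a i) :
    (Matrix.diagonal a + g • vecMulVec v v).charpoly.eval t =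
      ∏ i, (t - a i) - g * ∑ i, v i ^ 2 * ∏ j ∈ Finset.univ.erase i, (t - a j) := by
  have hne : ∀ i, t - a i ≠ 0 := fun i => sub_ne_zero.2 (ht i)
  rw [Matrix.eval_charpoly]
  have h1 : Matrix.scalar (Fin n) t - (Matrix.diagonal a + g • vecMulVec v v) =
      Matrix.diagonal (fun i => t - a i) + replicateCol Unit (fun i => -(g * v i)) *
        replicateRow Unit v := by
    ext i j
    by_cases hij : i = j
    · subst hij
      simp [Matrix.mul_apply, vecMulVec_apply]; ring
    · simp [Matrix.mul_apply, vecMulVec_apply, hij]; ring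
  have hd : IsUnit (Matrix.diagonal (fun i => t - a i)).det := by
    rw [det_diagonal, isUnit_iff_ne_zero]
    exact Finset.prod_ne_zero_iff.2 fun i _ => hne i
  have hinv : (Matrix.diagonal (fun i => t - a i))⁻¹ = Matrix.diagonal (fun i => (t - a i)⁻¹) := by
    apply Matrix.inv_eq_left_inv
    rw [diagonal_mul_diagonal, ← diagonal_one]
    congr 1
    funext i
    exact inv_mul_cancel₀ (hne i)
  rw [h1, det_add_replicateCol_mul_replicateRow hd, hinv, det_diagonal]
  have h2 : (1 + replicateRow Unit v * Matrix.diagonal (fun i => (t - a i)⁻¹) *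
      replicateCol Unit (fun i => -(g * v i))).det = 1 - g * ∑ i, v i ^ 2 * (t - a i)⁻¹ := by
    rw [det_unique]
    simp only [Matrix.add_apply, Matrix.one_apply_eq, Matrix.mul_apply (M := _ * _),
      mul_diagonal, replicateRow_apply, replicateCol_apply]
    rw [Finset.mul_sum, sub_eq_add_neg, ← Finset.sum_neg_distrib]
    congr 1
    exact Finset.sum_congr rfl fun i _ => by ring
  rw [h2, mul_sub, mul_one, mul_left_comm, Finset.mul_sum]
  congr 2
  refine Finset.sum_congr rfl fun i _ => ?_
  rw [← Finset.mul_prod_erase _ _ (Finset.mem_univ i)]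
  field_simp [hne i]

theorem r1_charpoly {n : ℕ} (a v : Fin n → ℝ) (g : ℝ) :
    (Matrix.diagonal a + g • vecMulVec v v).charpoly =
      ∏ i, (X - C (a i)) - C g * ∑ i, C (v i ^ 2) * ∏ j ∈ Finset.univ.erase i, (X - C (a j)) := by
  apply Polynomial.eq_of_infinite_eval_eq
  refine Set.Infinite.mono ?_ (Set.finite_range a).infinite_compl
  intro t ht
  have ht' : ∀ i, t ≠ a i := fun i h => ht ⟨i, h.symm⟩
  simp only [Set.mem_setOf_eq]
  rw [r1_eval_generic a v g t ht']
  simp [eval_prod, eval_finset_sum]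

theorem r1_eval_node {n : ℕ} (a v : Fin n → ℝ) (g : ℝ) (k : Fin n) :
    (Matrix.diagonal a + g • vecMulVec v v).charpoly.eval (a k) =
      - (g * v k ^ 2 * ∏ j ∈ Finset.univ.erase k, (a k - a j)) := by
  rw [r1_charpoly]
  simp only [eval_sub, eval_mul, eval_C, eval_X, eval_prod, eval_finset_sum]
  rw [Finset.prod_eq_zero (Finset.mem_univ k) (sub_self _), Finset.sum_eq_single k]
  · ring
  · intro b _ hb
    rw [Finset.prod_eq_zero (Finset.mem_erase.2 ⟨hb.symm, Finset.mem_univ k⟩) (sub_self _), mul_zero]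
  · simp

theorem r1_root {n : ℕ} (a v : Fin n → ℝ) (g : ℝ)
    (ha : StrictMono a) (hg : 0 < g) (hv : ∀ i, v i ≠ 0) (i : Fin n) :
    ∃ x, a i < x ∧ (∀ h : (i : ℕ) + 1 < n, x < a ⟨(i : ℕ) + 1, h⟩) ∧
      (Matrix.diagonal a + g • vecMulVec v v).charpoly.eval x = 0 := by
  have hE := r1_eval_node a v g
  have hmon := Matrix.charpoly_monic (Matrix.diagonal a + g • vecMulVec v v)
  have hdeg := Matrix.charpoly_degree_eq_dim (Matrix.diagonal a + g • vecMulVec v v)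
  generalize (Matrix.diagonal a + g • vecMulVec v v).charpoly = p at *
  have hc : ∀ k, 0 < g * v k ^ 2 := fun k => mul_pos hg (by have := hv k; positivity)
  by_cases h : (i : ℕ) + 1 < n
  · set k : Fin n := ⟨(i : ℕ) + 1, h⟩ with hk
    have hik : i < k := by simp [hk, Fin.lt_def]
    have haik := ha hik
    have hprod : 0 < ∏ j ∈ (Finset.univ.erase i).erase k, ((a i - a j) * (a k - a j)) := by
      refine Finset.prod_pos fun j hj => ?_
      simp only [Finset.mem_erase, Finset.mem_univ, and_true] at hj
      rcases lt_or_gt_of_ne hj.2 with hlt | hgt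
      · exact mul_pos (sub_pos.2 (ha hlt)) (sub_pos.2 (ha (hlt.trans hik)))
      · have : k < j := lt_of_le_of_ne (by simp only [hk, Fin.le_def, Fin.lt_def] at *; omega)
          (Ne.symm hj.1)
        exact mul_pos_of_neg_of_neg (sub_neg.2 (ha hgt)) (sub_neg.2 (ha this))
    have hneg : p.eval (a i) * p.eval (a k) < 0 := by
      rw [hE, hE, ← Finset.mul_prod_erase (Finset.univ.erase i) _
        (Finset.mem_erase.2 ⟨hik.ne', Finset.mem_univ k⟩),
        ← Finset.mul_prod_erase (Finset.univ.erase k) _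
        (Finset.mem_erase.2 ⟨hik.ne, Finset.mem_univ i⟩), Finset.erase_right_comm (a := k)]
      rw [Finset.prod_mul_distrib] at hprod
      have h3 := mul_pos (mul_pos (hc i) (hc k)) hprod
      have h4 := mul_pos (sub_pos.2 haik) (sub_pos.2 haik)
      have h5 := mul_pos h3 h4
      nlinarith [h5]
    have hcont : ContinuousOn (fun x => p.eval x) (Set.Icc (a i) (a k)) := p.continuous.continuousOn
    rcases mul_neg_iff.1 hneg with ⟨h1, h2⟩ | ⟨h1, h2⟩
    · obtain ⟨x, hx, hx0⟩ := intermediate_value_Ioo' haik.le hcont ⟨h2, h1⟩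
      exact ⟨x, hx.1, fun _ => hx.2, hx0⟩
    · obtain ⟨x, hx, hx0⟩ := intermediate_value_Ioo haik.le hcont ⟨h1, h2⟩
      exact ⟨x, hx.1, fun _ => hx.2, hx0⟩
  · have hneg : p.eval (a i) < 0 := by
      rw [hE, neg_lt_zero]
      refine mul_pos (hc i) (Finset.prod_pos fun j hj => sub_pos.2 (ha ?_))
      have := Finset.ne_of_mem_erase hj
      exact lt_of_le_of_ne (by simp only [Fin.le_def]; omega) this
    have hn : 0 < n := i.pos
    have ht := p.tendsto_atTop_of_leadingCoeff_nonneg (by rw [hdeg]; simpa using hn)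
      (by rw [hmon.leadingCoeff]; exact zero_le_one)
    obtain ⟨y, hy1, hy2⟩ := ((ht.eventually_gt_atTop 0).and (Filter.eventually_gt_atTop (a i))).exists
    obtain ⟨x, hx, hx0⟩ := intermediate_value_Ioo hy2.le p.continuous.continuousOn ⟨hneg, hy1⟩
    exact ⟨x, hx.1, fun h' => absurd h' h, hx0⟩

theorem rank_one_perturbation_interlacing
    {n : ℕ} (a v : Fin n → ℝ) (g : ℝ)
    (ha : StrictMono a) (hg : 0 < g) (hv : ∀ i, v i ≠ 0)
    (A : Matrix (Fin n) (Fin n) ℝ)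
    (hA : A = Matrix.diagonal a + g • vecMulVec v v) :
    ∃ μ : Fin n → ℝ, StrictMono μ ∧
      A.charpoly = ∏ i, (X - C (μ i)) ∧
      (∀ i, a i < μ i) ∧
      (∀ i : Fin n, ∀ h : (i : ℕ) + 1 < n, μ i < a ⟨(i : ℕ) + 1, h⟩) := by
  choose μ h1 h2 h3 using r1_root a v g ha hg hv
  rw [← hA] at h3
  have hmono : StrictMono μ := by
    intro i j hij
    have hlt : (i : ℕ) + 1 < n := by have := j.isLt; simp only [Fin.lt_def] at hij; omega
    refine (h2 i hlt).trans_le (le_trans (ha.monotone ?_) (h1 j).le)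
    simp only [Fin.le_def, Fin.lt_def] at *; omega
  refine ⟨μ, hmono, ?_, h1, h2⟩
  have hdvd : ∏ i, (X - C (μ i)) ∣ A.charpoly := by
    refine Finset.prod_dvd_of_coprime (fun i _ j _ hij => ?_) fun i _ => dvd_iff_isRoot.2 (h3 i)
    exact pairwise_coprime_X_sub_C hmono.injective hij
  refine (eq_of_monic_of_dvd_of_natDegree_le (monic_prod_of_monic _ _ fun i _ => monic_X_sub_C _)
    A.charpoly_monic hdvd ?_)
  rw [Matrix.charpoly_natDegree_eq_dim, natDegree_prod_of_monic _ _ fun i _ => monic_X_sub_C _]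
  simp
end

section
/- Let s(t) denote, for t > 0, the unique s > 1 with F(s) = t, where F(s) := s · (1/2) log((s + 1)/(s − 1)) − 1. Then as t → 0⁺, s(t) = 1/√(3t) + (3√3/10) √t + O(t^{3/2}); that is, there are constants C, t₀ > 0 such that |s(t) − 1/√(3t) − (3√3/10)√t| ≤ C t^{3/2} for all 0 < t < t₀. -/
/-- `F s = s · arcoth s − 1` with `arcoth s = (1/2) log((s+1)/(s−1))`. -/
noncomputable def F (s : ℝ) : ℝ := s * ((1 / 2) * Real.log ((s + 1) / (s - 1))) - 1

lemma le_of_sq_le_sq_aux {a b : ℝ} (h : a ^ 2 ≤ b ^ 2) (hb : 0 ≤ b) : a ≤ b :=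
  abs_le_of_sq_le_sq' h hb |>.2

/-- Bounds on `F (1/x)` from the power series of `artanh`. -/
lemma F_bounds (x : ℝ) (hx : 0 < x) (hx1 : x < 1) :
    x ^ 2 + 3 / 5 * x ^ 4 ≤ 3 * F (1 / x) ∧
    3 * F (1 / x) ≤ x ^ 2 + 3 / 5 * x ^ 4 + 3 / 7 * x ^ 6 / (1 - x ^ 2) := by
  have h := Real.hasSum_log_sub_log_of_abs_lt_one (x := x) (by rw [abs_of_pos hx]; exact hx1)
  have h3 := (hasSum_nat_add_iff' 3).2 h
  have hx2 : x ^ 2 < 1 := by nlinarith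
  have hg := (hasSum_geometric_of_lt_one (sq_nonneg x) hx2).mul_left (2 / 7 * x ^ 7)
  have h0 := h3.nonneg (fun i => by positivity)
  have h1 := hasSum_le (fun i => by
    have e : x ^ (2 * (i + 3) + 1) = x ^ 7 * (x ^ 2) ^ i := by
      rw [← pow_mul, ← pow_add]; congr 1; ring
    have e2 : (1 : ℝ) / (2 * ((i + 3 : ℕ) : ℝ) + 1) ≤ 1 / 7 := by
      apply one_div_le_one_div_of_le (by norm_num)
      push_cast
      have : (0 : ℝ) ≤ i := Nat.cast_nonneg i
      linarith
    have e3 : 0 ≤ x ^ 7 * (x ^ 2) ^ i := by positivity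
    show (2 : ℝ) * (1 / (2 * ((i + 3 : ℕ) : ℝ) + 1)) * x ^ (2 * (i + 3) + 1)
      ≤ 2 / 7 * x ^ 7 * (x ^ 2) ^ i
    rw [e]
    nlinarith [mul_le_mul_of_nonneg_right e2 e3]) h3 hg
  simp only [Finset.sum_range_succ, Finset.sum_range_zero] at h0 h1
  norm_num at h0 h1
  have hF : 3 * F (1 / x) = 3 / (2 * x) * (Real.log (1 + x) - Real.log (1 - x)) - 3 := by
    unfold F
    have : (1 / x + 1) / (1 / x - 1) = (1 + x) / (1 - x) := by
      have : 1 - x ≠ 0 := by linarith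
      field_simp
    rw [this, Real.log_div (by linarith) (by linarith)]
    field_simp
  have hc : 0 < 3 / (2 * x) := by positivity
  have hd : 0 < 1 - x ^ 2 := by linarith
  rw [hF]
  constructor
  · have := mul_le_mul_of_nonneg_left h0 hc.le
    have e : 3 / (2 * x) * (2 * x + 2 / 3 * x ^ 3 + 2 / 5 * x ^ 5)
      = 3 + x ^ 2 + 3 / 5 * x ^ 4 := by field_simp
    linarith
  · have := mul_le_mul_of_nonneg_left h1 hc.le
    have e : 3 / (2 * x) * (2 * x + 2 / 3 * x ^ 3 + 2 / 5 * x ^ 5)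
      = 3 + x ^ 2 + 3 / 5 * x ^ 4 := by field_simp
    have e2 : 3 / (2 * x) * (2 / 7 * x ^ 7 * (1 - x ^ 2)⁻¹)
      = 3 / 7 * x ^ 6 / (1 - x ^ 2) := by field_simp
    linarith

theorem inverse_of_F_asymptotics (s : ℝ → ℝ)
    (hs : ∀ t : ℝ, 0 < t → 1 < s t ∧ F (s t) = t) :
    ∃ C t₀ : ℝ, 0 < C ∧ 0 < t₀ ∧ ∀ t : ℝ, 0 < t → t < t₀ →
      |s t - 1 / Real.sqrt (3 * t) - (3 * Real.sqrt 3 / 10) * Real.sqrt t| ≤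
        C * t ^ ((3 : ℝ) / 2) := by
  refine ⟨12, 1 / 12, by norm_num, by norm_num, fun t ht ht0 => ?_⟩
  obtain ⟨h1, hF⟩ := hs t ht
  obtain ⟨x, hxdef⟩ : ∃ x, x = 1 / s t := ⟨_, rfl⟩
  have hx : 0 < x := by rw [hxdef]; positivity
  have hx1 : x < 1 := by rw [hxdef, div_lt_one (by linarith)]; exact h1
  have hsx : s t = 1 / x := by rw [hxdef, one_div_one_div]
  obtain ⟨hl, hu⟩ := F_bounds x hx hx1
  rw [← hsx, hF] at hl hu
  obtain ⟨u, hudef⟩ : ∃ u, u = Real.sqrt (3 * t) := ⟨_, rfl⟩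
  have hupos : 0 < u := by rw [hudef]; positivity
  have husq : u ^ 2 = 3 * t := by rw [hudef]; exact Real.sq_sqrt (by positivity)
  have hxu : x ≤ u := by
    apply le_of_sq_le_sq_aux _ hupos.le
    nlinarith [pow_pos hx 4]
  have hx2 : x ^ 2 < 1 / 4 := by nlinarith [pow_pos hx 4]
  have hr : 3 / 7 * x ^ 6 / (1 - x ^ 2) ≤ x ^ 6 := by
    rw [div_le_iff₀ (by linarith)]
    nlinarith [pow_pos hx 6]
  have hu' : u ^ 2 ≤ x ^ 2 + 3 / 5 * x ^ 4 + x ^ 6 := by linarith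
  have hl' : x ^ 2 + 3 / 5 * x ^ 4 ≤ u ^ 2 := by linarith
  have p5 := pow_pos hx 5
  have p3 := pow_pos hx 3
  have p6 := pow_pos hx 6
  have p7 : x ^ 7 ≤ x ^ 5 * (1 / 4) := by nlinarith
  have p8 : x ^ 8 ≤ x ^ 6 * (1 / 4) := by nlinarith
  have p10 : x ^ 10 ≤ x ^ 6 * (1 / 4) := by nlinarith [pow_pos hx 8]
  have hA : u ≤ x + 3 / 10 * x ^ 3 + x ^ 5 := by
    apply le_of_sq_le_sq_aux _ (by positivity)
    nlinarith [pow_pos hx 8, pow_pos hx 10]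
  have hB : x + 3 / 10 * x ^ 3 - x ^ 5 ≤ u := by
    apply le_of_sq_le_sq_aux _ hupos.le
    nlinarith [pow_pos hx 8, pow_pos hx 10]
  have hC1 : x * u ^ 2 ≤ x ^ 3 + 3 / 5 * x ^ 5 + x ^ 7 := by
    nlinarith [mul_le_mul_of_nonneg_left hu' hx.le]
  have hC2 : x ^ 3 + 3 / 5 * x ^ 5 ≤ x * u ^ 2 := by
    nlinarith [mul_le_mul_of_nonneg_left hl' hx.le]
  have hD : |u - x - 3 / 10 * (x * u ^ 2)| ≤ 2 * x ^ 5 := by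
    rw [abs_le]; constructor <;> linarith
  have hsqrt : 3 * Real.sqrt 3 / 10 * Real.sqrt t = 3 / 10 * u := by
    rw [hudef, Real.sqrt_mul (by norm_num)]; ring
  have hE : 1 / x - 1 / u - 3 / 10 * u = (u - x - 3 / 10 * (x * u ^ 2)) / (u * x) := by
    field_simp
  have ht32 : t ^ ((3 : ℝ) / 2) = t * Real.sqrt t := by
    rw [show (3 : ℝ) / 2 = 1 + 1 / 2 by norm_num, Real.rpow_add ht, Real.rpow_one,
      Real.sqrt_eq_rpow]
  have hs3 : Real.sqrt 3 ≤ 2 := by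
    rw [Real.sqrt_le_left (by norm_num)]; norm_num
  have hu2 : u ≤ 2 * Real.sqrt t := by
    rw [hudef, Real.sqrt_mul (by norm_num)]
    exact mul_le_mul_of_nonneg_right hs3 (Real.sqrt_nonneg _)
  rw [hsqrt, ← hudef, hsx, hE, abs_div, abs_of_pos (mul_pos hupos hx), ht32,
    div_le_iff₀ (mul_pos hupos hx)]
  have hG : 2 * x ^ 3 ≤ 12 * (t * Real.sqrt t) := by
    have a : x ^ 3 ≤ u ^ 3 := pow_le_pow_left₀ hx.le hxu 3
    have b : u ^ 3 = 3 * t * u := by rw [← husq]; ring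
    nlinarith [mul_le_mul_of_nonneg_left hu2 ht.le]
  calc _ ≤ 2 * x ^ 5 := hD
    _ = 2 * x ^ 3 * (x * x) := by ring
    _ ≤ 2 * x ^ 3 * (u * x) := by gcongr
    _ ≤ _ := by gcongr
end

section
/- Plasmon dispersion relation: let κ := (3/(4π))^{1/3} and ℏ > 0, and for k ∈ ℝ³ with 0 < |k| sufficiently small define λ_pl(k) := ℏ · 2κ |k| · s(|k|²/(4πκ)), where s(t) is the unique s > 1 solving s · (1/2) log((s + 1)/(s − 1)) − 1 = t. Then as |k| → 0, λ_pl(k) = 2ℏ + ℏ · (3/10) · √(3κ/π) · |k|² + O(|k|⁴); that is, there are constants C, r > 0 such that |λ_pl(k) − 2ℏ − ℏ (3/10) √(3κ/π) |k|²| ≤ C ℏ |k|⁴ whenever 0 < |k| < r. -/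
open scoped Real

/-- Two-sided expansion of `F` at infinity, in the variable `u = 1/s`. -/
lemma F_bounds_s16 (u : ℝ) (hu : 0 < u) (hu1 : u < 1) :
    u ^ 2 / 3 + u ^ 4 / 5 ≤ F u⁻¹ ∧
      (u ^ 2 ≤ 1 / 2 → F u⁻¹ ≤ u ^ 2 / 3 + u ^ 4 / 5 + 2 / 7 * u ^ 6) := by
  have h := Real.hasSum_log_sub_log_of_abs_lt_one (x := u) (by rw [abs_of_pos hu]; exact hu1)
  have hF : F u⁻¹ = (Real.log (1 + u) - Real.log (1 - u)) / (2 * u) - 1 := by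
    have h1 : (u⁻¹ + 1) / (u⁻¹ - 1) = (1 + u) / (1 - u) := by
      have : (1 - u) ≠ 0 := by linarith
      have h2 : u⁻¹ - 1 = (1 - u) / u := by field_simp
      have h3 : u⁻¹ + 1 = (1 + u) / u := by field_simp
      rw [h2, h3]; field_simp
    unfold F
    rw [h1, Real.log_div (by linarith) (by linarith)]
    field_simp
  set L := Real.log (1 + u) - Real.log (1 - u) with hL
  have h3 := (hasSum_nat_add_iff' 3).mpr h
  have hsum : ∑ i ∈ Finset.range 3, (2 : ℝ) * (1 / (2 * (i : ℝ) + 1)) * u ^ (2 * i + 1)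
      = 2 * u * (1 + u ^ 2 / 3 + u ^ 4 / 5) := by
    simp only [Finset.sum_range_succ, Finset.sum_range_zero]
    push_cast
    ring
  rw [hsum] at h3
  rw [hF]
  constructor
  · have h0 : 0 ≤ L - 2 * u * (1 + u ^ 2 / 3 + u ^ 4 / 5) :=
      h3.nonneg (fun i => by positivity)
    rw [le_sub_iff_add_le, le_div_iff₀ (by positivity)]
    linarith
  · intro hu2
    have hg := (hasSum_geometric_of_lt_one (r := u ^ 2) (by positivity) (by linarith)).mul_left
      (2 / 7 * u ^ 7)
    have hle := hasSum_le (fun i => by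
      have e : u ^ (2 * (i + 3) + 1) = u ^ 7 * (u ^ 2) ^ i := by ring
      rw [e]
      have : (1 : ℝ) / (2 * ((i + 3 : ℕ) : ℝ) + 1) ≤ 1 / 7 := by
        apply one_div_le_one_div_of_le (by norm_num)
        push_cast
        have : (0 : ℝ) ≤ i := Nat.cast_nonneg i
        linarith
      have hp : 0 ≤ u ^ 7 * (u ^ 2) ^ i := by positivity
      show _ ≤ 2 / 7 * u ^ 7 * (u ^ 2) ^ i
      nlinarith) h3 hg
    have hinv : (1 - u ^ 2)⁻¹ ≤ 2 := by
      rw [inv_le_comm₀ (by linarith) (by norm_num)]; linarith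
    have : 2 / 7 * u ^ 7 * (1 - u ^ 2)⁻¹ ≤ 2 / 7 * u ^ 7 * 2 := by gcongr
    rw [sub_le_iff_le_add, div_le_iff₀ (by positivity)]
    nlinarith

lemma key_bound (a σ : ℝ) (ha : 0 < a) (ha2 : a ^ 2 ≤ 1 / 2) (hσ : 1 < σ)
    (hF : F σ = a ^ 2 / 3) : |a * σ - (1 + 3 / 10 * a ^ 2)| ≤ 3 * a ^ 4 := by
  obtain ⟨u, hu⟩ : ∃ u, u = σ⁻¹ := ⟨_, rfl⟩
  have hσu : σ = u⁻¹ := by rw [hu, inv_inv]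
  have hu0 : 0 < u := by rw [hu]; positivity
  have hu1 : u < 1 := by rw [hu]; exact inv_lt_one_of_one_lt₀ hσ
  obtain ⟨h1, h2⟩ := F_bounds_s16 u hu0 hu1
  rw [← hσu, hF] at h1 h2
  have hq : 0 < u ^ 4 := by positivity
  have hua : u ^ 2 ≤ a ^ 2 := by linarith
  have h2 := h2 (by linarith)
  have hp : 0 < u ^ 2 := by positivity
  obtain ⟨z, hz⟩ : ∃ z, z = a * σ := ⟨_, rfl⟩
  have hz0 : 0 < z := by rw [hz]; positivity
  have hzu : a = z * u := by rw [hz, hσu]; field_simp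
  rw [← hz]
  have hau : a ^ 2 = z ^ 2 * u ^ 2 := by rw [hzu]; ring
  have l1 : 1 + 3 / 5 * u ^ 2 ≤ z ^ 2 := by
    apply le_of_mul_le_mul_right _ hp
    rw [← hau]; linarith
  have l2 : z ^ 2 ≤ 1 + 3 / 5 * u ^ 2 + 6 / 7 * u ^ 4 := by
    apply le_of_mul_le_mul_right _ hp
    rw [← hau]; linarith
  have h4 : u ^ 4 ≤ a ^ 4 := by gcongr; nlinarith
  have h6 : u ^ 6 ≤ 1 / 2 * u ^ 4 := by nlinarith
  have hw : 1 ≤ z + (1 + 3 / 10 * a ^ 2) := by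
    have := sq_nonneg a
    linarith
  have hd : |z ^ 2 - (1 + 3 / 10 * a ^ 2) ^ 2| ≤ 3 * a ^ 4 := by
    rw [abs_le]
    constructor <;> ring_nf at * <;> linarith
  have hf : z ^ 2 - (1 + 3 / 10 * a ^ 2) ^ 2
      = (z + (1 + 3 / 10 * a ^ 2)) * (z - (1 + 3 / 10 * a ^ 2)) := by ring
  rw [hf, abs_mul, abs_of_pos (by linarith)] at hd
  have := abs_nonneg (z - (1 + 3 / 10 * a ^ 2))
  nlinarith

theorem plasmon_dispersion_relation (hbar : ℝ) (hhbar : 0 < hbar)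
    (κ : ℝ) (hκ : κ = (3 / (4 * π)) ^ ((1 : ℝ) / 3))
    (s : ℝ → ℝ) (hs : ∀ t : ℝ, 0 < t → 1 < s t ∧ F (s t) = t)
    (lamPl : EuclideanSpace ℝ (Fin 3) → ℝ)
    (hlam : ∀ k : EuclideanSpace ℝ (Fin 3), 0 < ‖k‖ →
      lamPl k = hbar * (2 * κ * ‖k‖) * s (‖k‖ ^ 2 / (4 * π * κ))) :
    ∃ C r : ℝ, 0 < C ∧ 0 < r ∧ ∀ k : EuclideanSpace ℝ (Fin 3),
      0 < ‖k‖ → ‖k‖ < r →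
      |lamPl k - 2 * hbar - hbar * (3 / 10) * Real.sqrt (3 * κ / π) * ‖k‖ ^ 2| ≤
        C * hbar * ‖k‖ ^ 4 := by
  have hpi := Real.pi_pos
  have hκ0 : 0 < κ := by rw [hκ]; positivity
  have hκ3 : κ ^ 3 = 3 / (4 * π) := by
    rw [hκ, ← Real.rpow_natCast, ← Real.rpow_mul (by positivity)]
    norm_num
  have hsq : Real.sqrt (3 * κ / π) = 2 * κ ^ 2 := by
    have : 3 * κ / π = (2 * κ ^ 2) ^ 2 := by
      have : (2 * κ ^ 2) ^ 2 = 4 * κ * κ ^ 3 := by ring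
      rw [this, hκ3]; field_simp
    rw [this, Real.sqrt_sq (by positivity)]
  refine ⟨6 * κ ^ 4, 1 / (2 * κ), by positivity, by positivity, ?_⟩
  intro k hk hkr
  rw [hlam k hk, hsq]
  set x := ‖k‖
  have ht : x ^ 2 / (4 * π * κ) = (κ * x) ^ 2 / 3 := by
    have h' : κ ^ 3 * (4 * π) = 3 := by rw [hκ3]; field_simp
    rw [div_eq_div_iff (by positivity) (by norm_num)]
    linear_combination (-x ^ 2) * h'
  have hs' := hs (x ^ 2 / (4 * π * κ)) (by positivity)
  obtain ⟨σ, hσ⟩ : ∃ σ, σ = s (x ^ 2 / (4 * π * κ)) := ⟨_, rfl⟩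
  rw [← hσ] at hs' ⊢
  rw [ht] at hs'
  have hax : κ * x < 1 / 2 := by
    rw [lt_div_iff₀ (by positivity)] at hkr
    linarith
  have ha : 0 < κ * x := by positivity
  have hb := key_bound (κ * x) σ ha (by nlinarith) hs'.1 hs'.2
  have e : hbar * (2 * κ * x) * σ - 2 * hbar - hbar * (3 / 10) * (2 * κ ^ 2) * x ^ 2
      = (2 * hbar) * (κ * x * σ - (1 + 3 / 10 * (κ * x) ^ 2)) := by ring
  rw [e, abs_mul, abs_of_pos (by positivity)]
  calc _ ≤ 2 * hbar * (3 * (κ * x) ^ 4) := by gcongr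
    _ = _ := by ring
end

section
/- For every real constant c ≥ 0, the function λ ↦ log( 1 + c · (1 − λ · arctan(1/λ)) ) is well defined (its argument is positive) and Lebesgue integrable on (0, ∞). -/
open MeasureTheory

lemma lindhard_bounds (l : ℝ) (hl : 0 < l) :
    0 ≤ 1 - l * Real.arctan (1 / l) ∧ 1 - l * Real.arctan (1 / l) ≤ (1 + l ^ 2)⁻¹ := by
  have hx : 0 < 1 / l := by positivity
  have ht : 0 < Real.arctan (1 / l) := Real.arctan_pos.mpr hx
  have h1 : Real.arctan (1 / l) ≤ 1 / l := by
    have h := Real.lt_tan ht (Real.arctan_lt_pi_div_two _)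
    rw [Real.tan_arctan] at h
    exact h.le
  have h2 : l / (1 + l ^ 2) ≤ Real.arctan (1 / l) := by
    have hc := Real.cos_arctan_pos (1 / l)
    have e := Real.cos_sq_arctan (1 / l)
    have tt := Real.tan_arctan (1 / l)
    rw [Real.tan_eq_sin_div_cos, div_eq_iff hc.ne'] at tt
    have hs := Real.sin_le ht.le
    have hc1 := Real.cos_le_one (Real.arctan (1 / l))
    have : l / (1 + l ^ 2) =
        Real.sin (Real.arctan (1 / l)) * Real.cos (Real.arctan (1 / l)) := by
      rw [tt, mul_assoc, ← sq, e]
      field_simp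
      ring
    rw [this]
    nlinarith
  constructor
  · have := mul_le_mul_of_nonneg_left h1 hl.le
    rw [mul_one_div_cancel hl.ne'] at this
    linarith
  · have := mul_le_mul_of_nonneg_left h2 hl.le
    have e : (1 + l ^ 2)⁻¹ = 1 - l * (l / (1 + l ^ 2)) := by
      field_simp
      ring
    linarith

theorem log_lindhard_integrable (c : ℝ) (hc : 0 ≤ c) :
    (∀ lam : ℝ, 0 < lam → 0 < 1 + c * (1 - lam * Real.arctan (1 / lam))) ∧
    IntegrableOn (fun lam : ℝ => Real.log (1 + c * (1 - lam * Real.arctan (1 / lam))))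
      (Set.Ioi (0 : ℝ)) volume := by
  refine ⟨fun l hl => ?_, ?_⟩
  · have := mul_nonneg hc (lindhard_bounds l hl).1
    linarith
  · have hi : IntegrableOn (fun l : ℝ => c * (1 + l ^ 2)⁻¹) (Set.Ioi (0 : ℝ)) volume :=
      (integrable_inv_one_add_sq.const_mul c).integrableOn
    refine Integrable.mono' hi ?_ ?_
    · have hm : Measurable Real.arctan := Real.continuous_arctan.measurable
      have : Measurable (fun lam : ℝ =>
          Real.log (1 + c * (1 - lam * Real.arctan (1 / lam)))) := by
        fun_prop
      exact this.aestronglyMeasurable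
    · refine (ae_restrict_iff' measurableSet_Ioi).mpr (Filter.Eventually.of_forall ?_)
      intro l hl
      obtain ⟨h0, h1⟩ := lindhard_bounds l hl
      have h2 := mul_nonneg hc h0
      have h3 := mul_le_mul_of_nonneg_left h1 hc
      rw [Real.norm_of_nonneg (Real.log_nonneg (by linarith))]
      have := Real.log_le_sub_one_of_pos
        (show 0 < 1 + c * (1 - l * Real.arctan (1 / l)) by linarith)
      linarith
end
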